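/- Let Γ be a discrete abelian group and A, B ⊆ Γ nonempty. Then there exists a finite-index subgroup K ≤ Γ such that for every extreme invariant mean ν on ℓ^∞(Γ) satisfying ν(A+B) < ν(A) + ν(B), one has: ν(A+B) = ν(A+B+K); ν(A+B+K) = ν(A+K) + ν(B+K) − ν(K); and K = H(A+B+K), i.e. K is the stabilizer of A+B+K. Moreover, if there exists at least one extreme invariant mean ν with ν(A+B) < ν(A) + ν(B), then K is the unique finite-index subgroup of Γ with this property. -/

import Mathlib

open scoped Pointwise
open Filter

namespace SumsetMeans

variable (Γ : Type*) [AddCommGroup Γ] [TopologicalSpace Γ] [DiscreteTopology Γ]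

/-- The indicator function of `A ⊆ Γ` as a bounded (continuous, since `Γ` is discrete)
real-valued function, i.e. as an element of `ℓ^∞(Γ)`. -/
noncomputable def ind (A : Set Γ) : BoundedContinuousFunction Γ ℝ :=
  BoundedContinuousFunction.ofNormedAddCommGroup (Set.indicator A 1)
    continuous_of_discreteTopology 1
    (fun x => by by_cases h : x ∈ A <;> simp [Set.indicator_apply, h])

/-- The translate `τ_γ f`, given by `(τ_γ f)(x) = f (x - γ)`. -/
noncomputable def translate (γ : Γ) (f : BoundedContinuousFunction Γ ℝ) :
    BoundedContinuousFunction Γ ℝ :=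
  f.compContinuous ⟨fun x => x - γ, continuous_of_discreteTopology⟩

/-- An invariant mean on `ℓ^∞(Γ)`: a linear functional with `m 1 = 1`, nonnegative on
nonnegative functions, and invariant under all translations. -/
structure IsInvariantMean (m : BoundedContinuousFunction Γ ℝ →ₗ[ℝ] ℝ) : Prop where
  map_one : m 1 = 1
  nonneg : ∀ f : BoundedContinuousFunction Γ ℝ, (∀ x, 0 ≤ f x) → 0 ≤ m f
  invariant : ∀ (γ : Γ) (f : BoundedContinuousFunction Γ ℝ), m (translate Γ γ f) = m f

/-- The value `m(A) := m(1_A)` of a mean on a set `A ⊆ Γ`. -/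
noncomputable def mVal (m : BoundedContinuousFunction Γ ℝ →ₗ[ℝ] ℝ) (A : Set Γ) : ℝ :=
  m (ind Γ A)

/-- Upper Banach density: `d*(A) = sup { m(A) : m an invariant mean on ℓ^∞(Γ) }`. -/
noncomputable def ubd (A : Set Γ) : ℝ :=
  sSup {x : ℝ | ∃ m, IsInvariantMean Γ m ∧ mVal Γ m A = x}

/-- An extreme invariant mean: an extreme point of the convex set of invariant means. -/
def IsExtremeInvariantMean (ν : BoundedContinuousFunction Γ ℝ →ₗ[ℝ] ℝ) : Prop :=
  ν ∈ Set.extremePoints ℝ {m : BoundedContinuousFunction Γ ℝ →ₗ[ℝ] ℝ | IsInvariantMean Γ m}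

/-- `K` is a KJ-stabilizer of `A + B`: a finite-index subgroup such that for every extreme
invariant mean `ν` with `ν(A+B) < ν(A) + ν(B)` one has `ν(A+B) = ν(A+B+K)`, the Kneser
equation `ν(A+B+K) = ν(A+K) + ν(B+K) - ν(K)`, and `K` is the stabilizer of `A+B+K`. -/
def IsKJStabilizer (A B : Set Γ) (K : AddSubgroup Γ) : Prop :=
  K.FiniteIndex ∧
  ∀ ν : BoundedContinuousFunction Γ ℝ →ₗ[ℝ] ℝ, IsExtremeInvariantMean Γ ν →
    mVal Γ ν (A + B) < mVal Γ ν A + mVal Γ ν B →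
      mVal Γ ν (A + B) = mVal Γ ν (A + B + (K : Set Γ)) ∧
      mVal Γ ν (A + B + (K : Set Γ)) =
        mVal Γ ν (A + (K : Set Γ)) + mVal Γ ν (B + (K : Set Γ)) - mVal Γ ν (K : Set Γ) ∧
      (K : Set Γ) = {γ : Γ | A + B + (K : Set Γ) + {γ} = A + B + (K : Set Γ)}

/-- A translation-invariant, finitely additive probability on all subsets of `G`, together with
the two Chebyshev-type consequences of ergodicity for `e ↦ μ (A ∩ (e +ᵥ B))`, a function whose
mean is `μ A * μ B`. -/
structure IsErgodicContent {G : Type*} [AddCommGroup G] (μ : Set G → ℝ) : Prop where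
  nonneg : ∀ A, 0 ≤ μ A
  univ : μ Set.univ = 1
  union : ∀ A B, Disjoint A B → μ (A ∪ B) = μ A + μ B
  vadd : ∀ (e : G) (A : Set G), μ (e +ᵥ A) = μ A
  mul_le_mul : ∀ (A B D : Set G) (t : ℝ), (∀ e ∈ D, t ≤ μ (A ∩ (e +ᵥ B))) →
    t * μ D ≤ μ A * μ B
  mul_le : ∀ (A B D : Set G) (t : ℝ), (∀ e : G, μ (A ∩ (e +ᵥ B)) ≤ t) →
    (∀ e : G, (A ∩ (e +ᵥ B)).Nonempty → e ∈ D) → μ A * μ B ≤ t * μ D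

/-- The set `P` is a union of cosets of `H`. -/
def IsPeriodic {G : Type*} [AddCommGroup G] (H : AddSubgroup G) (P : Set G) : Prop :=
  ∀ p ∈ P, ∀ h ∈ H, p + h ∈ P

lemma mem_vadd_set_iff_sub_mem {G : Type*} [AddCommGroup G] {e x : G} {B : Set G} :
    x ∈ e +ᵥ B ↔ x - e ∈ B := by
  rw [Set.mem_vadd_set_iff_neg_vadd_mem, vadd_eq_add, neg_add_eq_sub]

namespace IsPeriodic

variable {G : Type*} [AddCommGroup G] {H K : AddSubgroup G} {P Q : Set G}

lemma mono (hP : IsPeriodic K P) (h : H ≤ K) : IsPeriodic H P :=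
  fun p hp x hx => hP p hp x (h hx)

lemma union (hP : IsPeriodic H P) (hQ : IsPeriodic H Q) : IsPeriodic H (P ∪ Q) := by
  rintro p (hp | hp) h hh
  · exact Or.inl (hP p hp h hh)
  · exact Or.inr (hQ p hp h hh)

lemma add_mem_iff (hP : IsPeriodic H P) {p h : G} (hh : h ∈ H) : p + h ∈ P ↔ p ∈ P := by
  refine ⟨fun hp => ?_, fun hp => hP p hp h hh⟩
  simpa using hP _ hp (-h) (neg_mem hh)

lemma diff (hP : IsPeriodic H P) (hQ : IsPeriodic H Q) : IsPeriodic H (P \ Q) :=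
  fun p hp h hh => ⟨hP p hp.1 h hh, fun hq => hp.2 ((hQ.add_mem_iff hh).1 hq)⟩

lemma vadd_subset (hP : IsPeriodic H P) {p : G} (hp : p ∈ P) : p +ᵥ (H : Set G) ⊆ P := by
  rintro _ ⟨h, hh, rfl⟩
  exact hP p hp h hh

lemma add_coe (S : Set G) (H : AddSubgroup G) : IsPeriodic H (S + (H : Set G)) := by
  rintro _ ⟨s, hs, h, hh, rfl⟩ k hk
  exact ⟨s, hs, h + k, add_mem hh hk, (add_assoc s h k).symm⟩

lemma add_coe_eq (hP : IsPeriodic H P) : P + (H : Set G) = P := by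
  refine Set.Subset.antisymm ?_ fun p hp => ⟨p, hp, 0, H.zero_mem, add_zero p⟩
  rintro _ ⟨p, hp, h, hh, rfl⟩
  exact hP p hp h hh

end IsPeriodic

lemma subset_add_coe {G : Type*} [AddCommGroup G] (S : Set G) (H : AddSubgroup G) :
    S ⊆ S + (H : Set G) :=
  fun s hs => ⟨s, hs, 0, H.zero_mem, add_zero s⟩

namespace IsErgodicContent

variable {G : Type*} [AddCommGroup G] {μ : Set G → ℝ} {A B C P Q : Set G} {H K : AddSubgroup G}

lemma empty (hμ : IsErgodicContent μ) : μ ∅ = 0 := by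
  have := hμ.union ∅ ∅ (Set.disjoint_empty _)
  simpa using this

lemma inter_add_diff (hμ : IsErgodicContent μ) (A B : Set G) :
    μ (A ∩ B) + μ (A \ B) = μ A := by
  rw [← hμ.union _ _ Set.disjoint_sdiff_inter.symm, Set.inter_union_sdiff]

lemma add_diff (hμ : IsErgodicContent μ) (h : A ⊆ B) : μ A + μ (B \ A) = μ B := by
  rw [← hμ.inter_add_diff B A, Set.inter_eq_self_of_subset_right h]

lemma mono (hμ : IsErgodicContent μ) (h : A ⊆ B) : μ A ≤ μ B := by
  linarith [hμ.add_diff h, hμ.nonneg (B \ A)]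

lemma le_one (hμ : IsErgodicContent μ) (A : Set G) : μ A ≤ 1 :=
  hμ.univ ▸ hμ.mono (Set.subset_univ A)

lemma union_add_inter (hμ : IsErgodicContent μ) (A B : Set G) :
    μ (A ∪ B) + μ (A ∩ B) = μ A + μ B := by
  have h1 := hμ.inter_add_diff B A
  have h2 := hμ.union A (B \ A) Set.disjoint_sdiff_right
  rw [Set.union_sdiff_self] at h2
  rw [Set.inter_comm B A] at h1
  linarith

lemma union_le (hμ : IsErgodicContent μ) (A B : Set G) : μ (A ∪ B) ≤ μ A + μ B := by
  linarith [hμ.union_add_inter A B, hμ.nonneg (A ∩ B)]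

lemma inter_neg_vadd (hμ : IsErgodicContent μ) (A B : Set G) (e : G) :
    μ (B ∩ (-e +ᵥ A)) = μ (A ∩ (e +ᵥ B)) := by
  rw [← hμ.vadd e (B ∩ (-e +ᵥ A)), Set.vadd_set_inter, vadd_neg_vadd, Set.inter_comm]

lemma neg_vadd_diff (hμ : IsErgodicContent μ) (X : Set G) (e : G) :
    μ ((-e +ᵥ X) \ X) = μ ((e +ᵥ X) \ X) := by
  have h1 := hμ.inter_add_diff (-e +ᵥ X) X
  have h2 := hμ.inter_add_diff (e +ᵥ X) X
  have h3 := hμ.inter_neg_vadd X X e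
  rw [hμ.vadd, Set.inter_comm] at h1 h2
  linarith

lemma preimage_mk (hμ : IsErgodicContent μ) (H : AddSubgroup G) (s : Finset (G ⧸ H)) :
    μ ((QuotientAddGroup.mk : G → G ⧸ H) ⁻¹' s) = s.card * μ H := by
  classical
  induction s using Finset.induction_on with
  | empty => simp [hμ.empty]
  | insert a s ha ih =>
    obtain ⟨g, rfl⟩ := QuotientAddGroup.mk_surjective a
    have h1 : (QuotientAddGroup.mk : G → G ⧸ H) ⁻¹' (insert (g : G ⧸ H) s : Finset (G ⧸ H)) =
        (g +ᵥ (H : Set G)) ∪ (QuotientAddGroup.mk : G → G ⧸ H) ⁻¹' s := by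
      ext x
      simp only [Finset.coe_insert, Set.mem_preimage, Set.mem_insert_iff, Set.mem_union,
        mem_vadd_set_iff_sub_mem, SetLike.mem_coe, eq_comm (a := (x : G ⧸ H)),
        QuotientAddGroup.eq, neg_add_eq_sub]
    rw [h1, hμ.union, ih, hμ.vadd, Finset.card_insert_of_notMem ha]
    · push_cast; ring
    · rw [Set.disjoint_left]
      intro x hx hx'
      rw [mem_vadd_set_iff_sub_mem] at hx
      have : (g : G ⧸ H) = x := QuotientAddGroup.eq.2 (by simpa [neg_add_eq_sub] using hx)
      exact ha (this ▸ hx')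

lemma finiteIndex (hμ : IsErgodicContent μ) (hH : 0 < μ H) : H.FiniteIndex := by
  rw [AddSubgroup.finiteIndex_iff_finite_quotient]
  by_contra hinf
  rw [not_finite_iff_infinite] at hinf
  obtain ⟨n, hn⟩ := exists_nat_gt (1 / μ H)
  obtain ⟨s, hs⟩ := Infinite.exists_subset_card_eq (G ⧸ H) n
  have h1 := hμ.preimage_mk H s
  have h2 := hμ.le_one ((QuotientAddGroup.mk : G → G ⧸ H) ⁻¹' s)
  rw [div_lt_iff₀ hH] at hn
  rw [hs] at h1
  linarith

lemma pos_of_finiteIndex (hμ : IsErgodicContent μ) (hH : H.FiniteIndex) : 0 < μ H := by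
  have := Fintype.ofFinite (G ⧸ H)
  have h1 := hμ.preimage_mk H Finset.univ
  rw [Finset.coe_univ, Set.preimage_univ, hμ.univ] at h1
  refine (hμ.nonneg _).lt_of_ne fun h => ?_
  rw [← h] at h1
  simp at h1

lemma exists_eq_mul (hμ : IsErgodicContent μ) (hH : H.FiniteIndex) (hP : IsPeriodic H P) :
    ∃ n : ℕ, μ P = n * μ H := by
  classical
  have := Fintype.ofFinite (G ⧸ H)
  refine ⟨_, (congrArg μ ?_).trans
    (hμ.preimage_mk H ((QuotientAddGroup.mk : G → G ⧸ H) '' P).toFinset)⟩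
  ext x
  simp only [Set.coe_toFinset, Set.mem_preimage, Set.mem_image]
  refine ⟨fun hx => ⟨x, hx, rfl⟩, ?_⟩
  rintro ⟨p, hp, hpx⟩
  simpa using hP p hp _ (QuotientAddGroup.eq.1 hpx)

lemma le_of_mem (hμ : IsErgodicContent μ) (hP : IsPeriodic H P) {p : G} (hp : p ∈ P) :
    μ H ≤ μ P :=
  hμ.vadd p (H : Set G) ▸ hμ.mono (hP.vadd_subset hp)

lemma eq_of_subset (hμ : IsErgodicContent μ) (hH : H.FiniteIndex) (hP : IsPeriodic H P)
    (hQ : IsPeriodic H Q) (hPQ : P ⊆ Q) (h : μ Q ≤ μ P) : P = Q := by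
  refine hPQ.antisymm fun x hx => ?_
  by_contra hxP
  linarith [hμ.le_of_mem (hQ.diff hP) ⟨hx, hxP⟩, hμ.add_diff hPQ, hμ.pos_of_finiteIndex hH]

lemma inter_vadd_le_inf (hμ : IsErgodicContent μ) (H K : AddSubgroup G) (e : G) :
    μ (H ∩ (e +ᵥ (K : Set G))) ≤ μ (H ⊓ K : AddSubgroup G) := by
  rcases ((H : Set G) ∩ (e +ᵥ (K : Set G))).eq_empty_or_nonempty with h | ⟨x, hx, hx'⟩
  · rw [h, hμ.empty]; exact hμ.nonneg _
  · rw [← hμ.vadd x ((H ⊓ K : AddSubgroup G) : Set G)]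
    refine hμ.mono ?_
    rintro y ⟨hy, hy'⟩
    rw [mem_vadd_set_iff_sub_mem] at *
    have h1 : y - x ∈ H := sub_mem hy hx
    have h2 : y - e - (x - e) ∈ K := sub_mem hy' hx'
    rw [sub_sub_sub_cancel_right] at h2
    exact ⟨h1, h2⟩

lemma mul_le_inf (hμ : IsErgodicContent μ) (H K : AddSubgroup G) :
    μ H * μ K ≤ μ (H ⊓ K : AddSubgroup G) := by
  have := hμ.mul_le H K Set.univ _ (hμ.inter_vadd_le_inf H K) (by simp)
  rwa [hμ.univ, mul_one] at this

/-- A set whose translates by a large set `Y` stay close to it is almost invariant under a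
whole subgroup containing `Y`. -/
lemma exists_addSubgroup_of_almost_invariant (hμ : IsErgodicContent μ) {δ κ : ℝ} (hδ : 0 < δ)
    (hκ : 0 < κ) : ∃ η > 0, ∀ X Y : Set G, δ ≤ μ Y → (∀ y ∈ Y, μ ((y +ᵥ X) \ X) ≤ η) →
      ∃ H : AddSubgroup G, Y ⊆ H ∧ ∀ h ∈ H, μ ((h +ᵥ X) \ X) ≤ κ := by
  obtain ⟨N, hN⟩ := exists_nat_gt (1 / δ)
  rw [div_lt_iff₀ hδ] at hN
  refine ⟨κ / (2 * 5 ^ N), by positivity, fun X Y hY hXY => ?_⟩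
  set η := κ / (2 * 5 ^ N) with hη
  have hη0 : 0 < η := by positivity
  let S : ℝ → Set G := fun θ => {γ | μ ((γ +ᵥ X) \ X) ≤ θ}
  have S_mono : ∀ {θ θ'}, θ ≤ θ' → S θ ⊆ S θ' := fun h γ hγ => le_trans hγ h
  have S_neg : ∀ {θ γ}, γ ∈ S θ → -γ ∈ S θ := fun {θ γ} hγ => (hμ.neg_vadd_diff X γ).trans_le hγ
  have S_add : ∀ {θ θ' γ γ'}, γ ∈ S θ → γ' ∈ S θ' → γ + γ' ∈ S (θ + θ') := by
    intro θ θ' γ γ' hγ hγ'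
    have h1 : ((γ + γ') +ᵥ X) \ X ⊆ ((γ +ᵥ X) \ X) ∪ (γ +ᵥ ((γ' +ᵥ X) \ X)) := by
      intro x hx
      simp only [Set.mem_sdiff, Set.mem_union, mem_vadd_set_iff_sub_mem, ← sub_sub] at hx ⊢
      tauto
    have h2 := (hμ.mono h1).trans (hμ.union_le _ _)
    rw [hμ.vadd] at h2
    exact h2.trans (add_le_add hγ hγ')
  have hYS : Y ⊆ S η := hXY
  have hstab : ∃ j < N, S (4 * (5 ^ j * η)) ⊆ S (2 * (5 ^ j * η)) := by
    by_contra! hno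
    have hgrow : ∀ j ≤ N, j * δ ≤ μ (S (5 ^ j * η)) := by
      intro j
      induction j with
      | zero => intro _; simpa using hμ.nonneg _
      | succ j ih =>
        intro hj
        obtain ⟨γ, hγ4, hγ2⟩ := Set.not_subset.1 (hno j hj)
        set θ := 5 ^ j * η with hθ
        have hηθ : η ≤ θ := le_mul_of_one_le_left hη0.le (one_le_pow₀ (by norm_num))
        have hdisj : Disjoint (S θ) (γ +ᵥ S θ) := by
          rw [Set.disjoint_left]
          intro x hx hx'
          rw [mem_vadd_set_iff_sub_mem] at hx'
          refine hγ2 ?_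
          have := S_add hx (S_neg hx')
          rwa [← sub_eq_add_neg, sub_sub_cancel, ← two_mul] at this
        have hsub : S θ ∪ (γ +ᵥ S θ) ⊆ S (5 ^ (j + 1) * η) := by
          have h5 : 5 ^ (j + 1) * η = 4 * θ + θ := by rw [hθ]; ring
          rw [h5]
          refine Set.union_subset (S_mono (by linarith)) fun x hx => ?_
          rw [mem_vadd_set_iff_sub_mem] at hx
          simpa using S_add hγ4 hx
        have h1 := hμ.mono hsub
        rw [hμ.union _ _ hdisj, hμ.vadd] at h1
        have h2 := hμ.mono (hYS.trans (S_mono hηθ))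
        have h3 := ih (by lia)
        push_cast
        linarith
    linarith [hgrow N le_rfl, hμ.le_one (S (5 ^ N * η))]
  obtain ⟨j, hj, hS⟩ := hstab
  set θ := 5 ^ j * η with hθ
  have hηθ : η ≤ θ := le_mul_of_one_le_left hη0.le (one_le_pow₀ (by norm_num))
  have hθκ : 2 * θ ≤ κ := by
    have h1 : θ ≤ 5 ^ N * η :=
      mul_le_mul_of_nonneg_right (pow_le_pow_right₀ (by norm_num) hj.le) hη0.le
    have h2 : 2 * (5 ^ N * η) = κ := by rw [hη]; field_simp
    linarith
  refine ⟨{ carrier := S (2 * θ), add_mem' := ?_, zero_mem' := ?_, neg_mem' := S_neg }, ?_, ?_⟩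
  · intro a b ha hb
    refine hS ?_
    have := S_add ha hb
    rwa [← two_mul, ← mul_assoc, show (2 : ℝ) * 2 = 4 by norm_num] at this
  · change μ (((0 : G) +ᵥ X) \ X) ≤ 2 * θ
    rw [zero_vadd, Set.sdiff_self, hμ.empty]
    linarith
  · exact hYS.trans (S_mono (by linarith))
  · exact fun h hh => le_trans hh hθκ

/-- Dyson transforms that keep `0` in both summands can be iterated until the smaller set cannot
shrink by more than `ε` any further. -/
lemma exists_almost_minimal_pair (hμ : IsErgodicContent μ) (hAB : A + B ⊆ C) (hA : 0 ∈ A)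
    (hB : 0 ∈ B) {ε : ℝ} (hε : 0 < ε) :
    ∃ (X Y : Set G) (r : ℝ), 0 ∈ X ∧ 0 ∈ Y ∧ X + Y ⊆ C ∧ μ X + μ Y = μ A + μ B ∧
      μ A + μ B - μ C ≤ r ∧ r ≤ μ Y ∧ μ Y ≤ r + ε ∧ (∀ e ∈ X, r ≤ μ (X ∩ (e +ᵥ Y))) ∧
      ∀ d ∈ X + Y, r - ε ≤ μ (X ∩ (d +ᵥ Y)) := by
  let IsPair : Set G → Set G → Prop := fun X Y =>
    0 ∈ X ∧ 0 ∈ Y ∧ X + Y ⊆ C ∧ μ X + μ Y = μ A + μ B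
  let R : Set ℝ := {y | ∃ X Y, IsPair X Y ∧ μ Y = y}
  have hR : R.Nonempty := ⟨μ B, A, B, ⟨hA, hB, hAB, rfl⟩, rfl⟩
  have hbound : ∀ y ∈ R, μ A + μ B - μ C ≤ y := by
    rintro _ ⟨X, Y, ⟨_, hY, hXY, hs⟩, rfl⟩
    have : X ⊆ C := fun x hx => hXY ⟨x, hx, 0, hY, add_zero x⟩
    linarith [hμ.mono this]
  have hbdd : BddBelow R := ⟨_, hbound⟩
  have hle : ∀ {X Y}, IsPair X Y → sInf R ≤ μ Y := fun {X Y} h => csInf_le hbdd ⟨X, Y, h, rfl⟩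
  have hstep : ∀ {X Y e}, IsPair X Y → e ∈ X → IsPair (X ∪ (e +ᵥ Y)) (Y ∩ (-e +ᵥ X)) := by
    rintro X Y e ⟨hX, hY, hXY, hs⟩ he
    refine ⟨Or.inl hX, ⟨hY, ?_⟩, ?_, ?_⟩
    · simpa [mem_vadd_set_iff_sub_mem] using he
    · rintro _ ⟨x, hx, y, ⟨hy, hy'⟩, rfl⟩
      rw [mem_vadd_set_iff_sub_mem, sub_neg_eq_add] at hy'
      rcases hx with hx | hx
      · exact hXY ⟨x, hx, y, hy, rfl⟩
      · rw [mem_vadd_set_iff_sub_mem] at hx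
        exact hXY ⟨y + e, hy', x - e, hx, by simp only; abel⟩
    · rw [hμ.inter_neg_vadd, hμ.union_add_inter, hμ.vadd, hs]
  have hmin : ∀ {X Y e}, IsPair X Y → e ∈ X → sInf R ≤ μ (X ∩ (e +ᵥ Y)) := by
    intro X Y e h he
    rw [← hμ.inter_neg_vadd]
    exact hle (hstep h he)
  obtain ⟨_, ⟨X, Y, hp, rfl⟩, hlt⟩ := exists_lt_of_csInf_lt hR (lt_add_of_pos_right (sInf R) hε)
  refine ⟨X, Y, sInf R, hp.1, hp.2.1, hp.2.2.1, hp.2.2.2, le_csInf hR hbound, hle hp, hlt.le,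
    fun e he => hmin hp he, ?_⟩
  rintro _ ⟨e, he, y, hy, rfl⟩
  have h1 : sInf R ≤ μ ((X ∪ (e +ᵥ Y)) ∩ ((e + y) +ᵥ (Y ∩ (-e +ᵥ X)))) :=
    hmin (hstep hp he) (Or.inr (mem_vadd_set_iff_sub_mem.2 (by simpa using hy)))
  have h2 : (X ∪ (e +ᵥ Y)) ∩ ((e + y) +ᵥ (Y ∩ (-e +ᵥ X))) ⊆
      (X ∩ ((e + y) +ᵥ Y)) ∪ ((e +ᵥ Y) \ X) := by
    intro x hx
    simp only [Set.mem_inter_iff, Set.mem_union, Set.mem_sdiff, mem_vadd_set_iff_sub_mem] at hx ⊢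
    tauto
  have h3 := (hμ.mono h2).trans (hμ.union_le _ _)
  have h4 := hμ.inter_add_diff (e +ᵥ Y) X
  rw [hμ.vadd, Set.inter_comm] at h4
  have h5 := hmin hp he
  simp only
  linarith

lemma exists_periodic_zero_mem (hμ : IsErgodicContent μ) (hAB : A + B ⊆ C) (hA : 0 ∈ A)
    (hB : 0 ∈ B) (hlt : μ C < μ A + μ B) :
    ∃ (H : AddSubgroup G) (P : Set G), H.FiniteIndex ∧ IsPeriodic H P ∧ 0 ∈ P ∧ μ (P \ C) = 0 ∧
      μ A + μ B ≤ μ P + μ H := by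
  set δ := μ A + μ B - μ C with hδ
  have hδ0 : 0 < δ := by linarith
  obtain ⟨η, hη, hsub⟩ := hμ.exists_addSubgroup_of_almost_invariant hδ0
    (show 0 < δ ^ 2 / 8 by positivity)
  obtain ⟨X, Y, r, hX, hY, hXY, hs, hδr, hrY, hYr, hXe, hXd⟩ :=
    hμ.exists_almost_minimal_pair hAB hA hB
      (show 0 < min (δ * η / 4) (δ ^ 2 / 8) by positivity)
  set ε := min (δ * η / 4) (δ ^ 2 / 8) with hε
  have hε0 : 0 < ε := by positivity
  have hε1 : ε ≤ δ * η / 4 := min_le_left _ _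
  have hε2 : ε ≤ δ ^ 2 / 8 := min_le_right _ _
  have hδ1 : δ ≤ 1 := by linarith [hμ.le_one Y]
  have hδδ : δ ^ 2 ≤ δ := by nlinarith
  have hX1 := hμ.le_one X
  have hX0 := hμ.nonneg X
  have hXYr : μ X * μ Y ≤ μ X * (r + ε) := mul_le_mul_of_nonneg_left hYr hX0
  have hD := hμ.mul_le_mul X Y (X + Y) (r - ε) hXd
  have hDX : μ (X + Y) ≤ μ X + η := by
    by_contra! hcon
    nlinarith
  obtain ⟨H, hYH, hH⟩ := hsub X Y (hδr.trans hrY) fun y hy => by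
    have h1 : X ⊆ X + Y := fun x hx => ⟨x, hx, 0, hY, add_zero x⟩
    have h2 : (y +ᵥ X) \ X ⊆ (X + Y) \ X := by
      refine Set.sdiff_subset_sdiff_left ?_
      rintro _ ⟨x, hx, rfl⟩
      exact ⟨x, hx, y, hy, add_comm x y⟩
    linarith [hμ.mono h2, hμ.add_diff h1]
  have hYH' := hμ.mono hYH
  have hXP := subset_add_coe X H
  refine ⟨H, X + H, hμ.finiteIndex (by linarith), IsPeriodic.add_coe X H, hXP hX, ?_,
    by linarith [hμ.mono hXP]⟩
  have hPd : ∀ d ∈ X + (H : Set G), r - δ ^ 2 / 8 ≤ μ (X ∩ (d +ᵥ Y)) := by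
    rintro _ ⟨x, hx, h, hh, rfl⟩
    have h1 : h +ᵥ (X ∩ (x +ᵥ Y)) ⊆ (X ∩ ((x + h) +ᵥ Y)) ∪ ((h +ᵥ X) \ X) := by
      intro z hz
      simp only [Set.mem_inter_iff, Set.mem_union, Set.mem_sdiff, mem_vadd_set_iff_sub_mem,
        sub_sub, add_comm x h] at hz ⊢
      tauto
    have h2 := (hμ.mono h1).trans (hμ.union_le _ _)
    rw [hμ.vadd] at h2
    simp only
    linarith [hH h hh, hXe x hx]
  have hP := hμ.mul_le_mul X Y (X + H) (r - δ ^ 2 / 8) hPd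
  have hPX : μ ((X + (H : Set G)) \ X) < δ := by
    by_contra! hcon
    have := hμ.add_diff hXP
    nlinarith
  set Z := (X + (H : Set G)) \ C with hZ
  have hZY := hμ.mul_le Z Y ((X + (H : Set G)) \ X) (μ Z)
    (fun e => hμ.mono Set.inter_subset_left) (by
      rintro e ⟨z, ⟨hz, hzC⟩, hze⟩
      rw [mem_vadd_set_iff_sub_mem] at hze
      refine ⟨?_, fun heX => hzC (hXY ⟨e, heX, z - e, hze, add_sub_cancel e z⟩)⟩
      simpa using IsPeriodic.add_coe X H z hz _ (neg_mem (hYH hze)))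
  by_contra hne
  have hpos : 0 < μ Z := (hμ.nonneg Z).lt_of_ne' hne
  have := le_of_mul_le_mul_left hZY hpos
  linarith

lemma exists_periodic_add_mem (hμ : IsErgodicContent μ) {a b : G} (ha : a ∈ A) (hb : b ∈ B)
    (hlt : μ (A + B) < μ A + μ B) :
    ∃ (H : AddSubgroup G) (P : Set G), H.FiniteIndex ∧ IsPeriodic H P ∧ a + b ∈ P ∧
      μ (P \ (A + B)) = 0 ∧ μ A + μ B ≤ μ P + μ H := by
  obtain ⟨H, P, hH, hP, h0, hPC, hle⟩ :=
    hμ.exists_periodic_zero_mem (A := -a +ᵥ A) (B := -b +ᵥ B) (C := -(a + b) +ᵥ (A + B))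
      (by
        rintro _ ⟨x, hx, y, hy, rfl⟩
        rw [mem_vadd_set_iff_sub_mem] at *
        exact ⟨_, hx, _, hy, by simp only; abel⟩)
      (by simpa [mem_vadd_set_iff_sub_mem] using ha)
      (by simpa [mem_vadd_set_iff_sub_mem] using hb) (by simpa only [hμ.vadd] using hlt)
  refine ⟨H, (a + b) +ᵥ P, hH, ?_, ?_, ?_, by simpa only [hμ.vadd] using hle⟩
  · intro p hp h hh
    rw [mem_vadd_set_iff_sub_mem] at *
    simpa [add_sub_right_comm] using hP _ hp h hh
  · simpa [mem_vadd_set_iff_sub_mem] using h0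
  · rw [← hμ.vadd (a + b), Set.vadd_set_sdiff, vadd_neg_vadd] at hPC
    exact hPC

lemma lt_of_mem_diff (hμ : IsErgodicContent μ) (hH : H.FiniteIndex) (hK : K.FiniteIndex)
    (hP : IsPeriodic H P) (hQ : IsPeriodic K Q) {x : G} (hx : x ∈ Q \ P)
    (hQP : μ (Q \ P) + μ (H ⊓ K : AddSubgroup G) < μ H)
    (hPQ : μ (P \ Q) + μ (H ⊓ K : AddSubgroup G) < μ K) : μ K < μ H := by
  set ℓ := μ (H ⊓ K : AddSubgroup G) with hℓ
  have hℓ0 : 0 < ℓ := hμ.pos_of_finiteIndex inferInstance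
  set U : Set G := {h | h ∈ H ∧ x + h ∈ Q} with hU
  set V : Set G := {k | k ∈ K ∧ x - k ∈ P} with hV
  have hUH : U ⊆ H := fun u hu => hu.1
  have hVK : V ⊆ K := fun v hv => hv.1
  have hUper : IsPeriodic (H ⊓ K) U := fun u hu l hl =>
    ⟨add_mem hu.1 hl.1, by rw [← add_assoc]; exact hQ _ hu.2 l hl.2⟩
  have hVper : IsPeriodic (H ⊓ K) V := fun v hv l hl =>
    ⟨add_mem hv.1 hl.2, by
      rw [← sub_sub, sub_eq_add_neg]; exact hP _ hv.2 _ (neg_mem hl.1)⟩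
  have hHper : IsPeriodic (H ⊓ K) (H : Set G) := fun h hh l hl => add_mem hh hl.1
  have hKper : IsPeriodic (H ⊓ K) (K : Set G) := fun k hk l hl => add_mem hk hl.2
  have hle : ∀ S T : Set G, S ⊆ H → T ⊆ K → ∀ e : G, μ (S ∩ (e +ᵥ T)) ≤ ℓ :=
    fun S T hS hT e => (hμ.mono (Set.inter_subset_inter hS (Set.vadd_set_mono hT))).trans
      (hμ.inter_vadd_le_inf H K e)
  have h1 := hμ.mul_le U (K \ V) (-x +ᵥ (Q \ P)) ℓ (hle _ _ hUH Set.sdiff_subset) (by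
    rintro e ⟨z, ⟨hzH, hzQ⟩, hz⟩
    rw [mem_vadd_set_iff_sub_mem] at hz ⊢
    obtain ⟨hzK, hzV⟩ := hz
    refine ⟨?_, fun hmem => hzV ⟨hzK, ?_⟩⟩
    · have := hQ _ hzQ _ (neg_mem hzK)
      convert this using 1; abel
    · have := hP _ hmem _ (neg_mem hzH)
      convert this using 1; abel)
  have h2 := hμ.mul_le (H \ U) V (-x +ᵥ (P \ Q)) ℓ (hle _ _ Set.sdiff_subset hVK) (by
    rintro e ⟨z, ⟨hzH, hzU⟩, hz⟩
    rw [mem_vadd_set_iff_sub_mem] at hz ⊢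
    obtain ⟨hzK, hzP⟩ := hz
    refine ⟨?_, fun hmem => hzU ⟨hzH, ?_⟩⟩
    · have := hP _ hzP _ hzH
      convert this using 1; abel
    · have := hQ _ hmem _ hzK
      convert this using 1; abel)
  rw [hμ.vadd] at h1 h2
  have hsumH := hμ.add_diff hUH
  have hsumK := hμ.add_diff hVK
  have hUℓ : ℓ ≤ μ U := hμ.le_of_mem hUper (p := 0) ⟨H.zero_mem, by simpa using hx.1⟩
  have hVℓ' : ℓ ≤ μ (K \ V) := hμ.le_of_mem (hKper.diff hVper) (p := 0)
    ⟨K.zero_mem, fun h => hx.2 (by simpa using h.2)⟩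
  rcases V.eq_empty_or_nonempty with hVe | ⟨v, hv⟩
  · have : x +ᵥ (K : Set G) ⊆ Q \ P := by
      rintro _ ⟨k, hk, rfl⟩
      refine ⟨hQ x hx.1 k hk, fun hmem => ?_⟩
      have : -k ∈ V := ⟨neg_mem hk, by simpa [sub_neg_eq_add] using hmem⟩
      simp [hVe] at this
    have := hμ.mono this
    rw [hμ.vadd] at this
    linarith
  rcases ((H : Set G) \ U).eq_empty_or_nonempty with hUe | ⟨u, hu⟩
  · have : x +ᵥ (H : Set G) ⊆ Q \ P := by
      rintro _ ⟨h, hh, rfl⟩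
      refine ⟨?_, fun hmem => hx.2 ((hP.add_mem_iff hh).1 hmem)⟩
      by_contra hmem
      have : h ∈ (H : Set G) \ U := ⟨hh, fun hU => hmem hU.2⟩
      simp [hUe] at this
    have := hμ.mono this
    rw [hμ.vadd] at this
    linarith
  have hVℓ : ℓ ≤ μ V := hμ.le_of_mem hVper hv
  have hUℓ' : ℓ ≤ μ (H \ U) := hμ.le_of_mem (hHper.diff hUper) hu
  exfalso
  have h3 : ℓ * μ (Q \ P) < ℓ * (μ U + μ (H \ U) - ℓ) := by gcongr; linarith
  have h4 : ℓ * μ (P \ Q) < ℓ * (μ V + μ (K \ V) - ℓ) := by gcongr; linarith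
  have h5 : ℓ * (μ (K \ V) - ℓ) ≤ μ U * (μ (K \ V) - ℓ) := by gcongr
  have h6 : ℓ * (μ (H \ U) - ℓ) ≤ μ V * (μ (H \ U) - ℓ) := by gcongr
  linarith

/-- Kneser's lemma on unions of periodic sets. -/
lemma exists_periodic_union (hμ : IsErgodicContent μ) (hH : H.FiniteIndex) (hK : K.FiniteIndex)
    (hP : IsPeriodic H P) (hQ : IsPeriodic K Q) {s : ℝ} (hPs : s ≤ μ P + μ H)
    (hQs : s ≤ μ Q + μ K) :
    ∃ L : AddSubgroup G, L.FiniteIndex ∧ IsPeriodic L (P ∪ Q) ∧ s ≤ μ (P ∪ Q) + μ L := by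
  by_cases hPQ : P ⊆ Q
  · exact ⟨K, hK, by rwa [Set.union_eq_self_of_subset_left hPQ],
      by rwa [Set.union_eq_self_of_subset_left hPQ]⟩
  by_cases hQP : Q ⊆ P
  · exact ⟨H, hH, by rwa [Set.union_eq_self_of_subset_right hQP],
      by rwa [Set.union_eq_self_of_subset_right hQP]⟩
  refine ⟨H ⊓ K, inferInstance, (hP.mono inf_le_left).union (hQ.mono inf_le_right), ?_⟩
  by_contra! hcon
  obtain ⟨x, hx⟩ := Set.not_subset.1 hQP
  obtain ⟨y, hy⟩ := Set.not_subset.1 hPQ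
  have h1 := hμ.add_diff (Set.subset_union_left (s := P) (t := Q))
  have h2 := hμ.add_diff (Set.subset_union_right (s := P) (t := Q))
  rw [Set.union_sdiff_left] at h1
  rw [Set.union_sdiff_right] at h2
  have h3 := hμ.lt_of_mem_diff hH hK hP hQ hx (by linarith) (by linarith)
  have h4 := hμ.lt_of_mem_diff hK hH hQ hP hy (by rw [inf_comm]; linarith)
    (by rw [inf_comm]; linarith)
  exact lt_asymm h3 h4

theorem exists_addSubgroup_of_small_sum (hμ : IsErgodicContent μ) (hA : A.Nonempty)
    (hB : B.Nonempty) (hlt : μ (A + B) < μ A + μ B) :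
    ∃ H : AddSubgroup G, H.FiniteIndex ∧ μ (A + B + H) = μ (A + B) ∧
      μ A + μ B ≤ μ (A + B + H) + μ H := by
  set C := A + B with hC
  set δ := μ A + μ B - μ C with hδ
  have hδ0 : 0 < δ := by linarith
  let IsGood : AddSubgroup G → Set G → Prop := fun H P =>
    H.FiniteIndex ∧ IsPeriodic H P ∧ μ (P \ C) = 0 ∧ μ A + μ B ≤ μ P + μ H
  have hgood_le : ∀ {H P}, IsGood H P → μ P ≤ μ C := by
    rintro H P ⟨_, _, hPC, _⟩
    linarith [hμ.inter_add_diff P C, hμ.mono (Set.inter_subset_right : P ∩ C ⊆ C)]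
  have hex : ∀ c ∈ C, ∃ H P, IsGood H P ∧ c ∈ P := by
    rintro _ ⟨a, ha, b, hb, rfl⟩
    obtain ⟨H, P, hH, hP, hc, hPC, hle⟩ := hμ.exists_periodic_add_mem ha hb hlt
    exact ⟨H, P, ⟨hH, hP, hPC, hle⟩, hc⟩
  let R : Set ℝ := {y | ∃ H P, IsGood H P ∧ μ P = y}
  have hR : R.Nonempty := by
    obtain ⟨c, hc⟩ := hA.add hB
    obtain ⟨H, P, h, -⟩ := hex c hc
    exact ⟨_, H, P, h, rfl⟩
  have hbdd : BddAbove R := ⟨1, by rintro _ ⟨H, P, h, rfl⟩; exact hμ.le_one P⟩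
  obtain ⟨_, ⟨H, P, hg, rfl⟩, hnear⟩ :=
    exists_lt_of_lt_csSup hR (sub_lt_self (sSup R) (pow_pos hδ0 2))
  have hCP : C ⊆ P := by
    intro c hc
    by_contra hcP
    obtain ⟨K, Q, hg', hcQ⟩ := hex c hc
    obtain ⟨L, hL, hPQ, hle⟩ := hμ.exists_periodic_union hg.1 hg'.1 hg.2.1 hg'.2.1 hg.2.2.2
      hg'.2.2.2
    have hnull : μ ((P ∪ Q) \ C) = 0 := by
      rw [Set.union_sdiff_distrib]
      refine le_antisymm ((hμ.union_le _ _).trans ?_) (hμ.nonneg _)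
      rw [hg.2.2.1, hg'.2.2.1, add_zero]
    have h1 : μ (P ∪ Q) ≤ sSup R := le_csSup hbdd ⟨L, P ∪ Q, ⟨hL, hPQ, hnull, hle⟩, rfl⟩
    have h2 := hμ.add_diff (Set.subset_union_left (s := P) (t := Q))
    rw [Set.union_sdiff_left] at h2
    have h3 : μ (H ⊓ K : AddSubgroup G) ≤ μ (Q \ P) :=
      hμ.le_of_mem ((hg'.2.1.mono inf_le_right).diff (hg.2.1.mono inf_le_left)) ⟨hcQ, hcP⟩
    have h4 := hμ.mul_le_inf H K
    have h5 : δ ≤ μ H := by linarith [hgood_le hg, hg.2.2.2]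
    have h6 : δ ≤ μ K := by linarith [hgood_le hg', hg'.2.2.2]
    have h7 : δ * δ ≤ μ H * μ K := _root_.mul_le_mul h5 h6 hδ0.le (hμ.nonneg _)
    linarith [sq δ]
  have hCH : C + (H : Set G) ⊆ P := by
    rintro _ ⟨c, hc, h, hh, rfl⟩
    exact hg.2.1 c (hCP hc) h hh
  have h1 := hμ.mono hCH
  have h2 := hμ.mono (subset_add_coe C H)
  have h3 := hgood_le hg
  exact ⟨H, hg.1, by linarith, by linarith [hg.2.2.2]⟩

end IsErgodicContent

lemma add_singleton_eq_vadd {G : Type*} [AddCommGroup G] (S : Set G) (γ : G) :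
    S + {γ} = γ +ᵥ S := by
  ext x
  simp [mem_vadd_set_iff_sub_mem, sub_eq_add_neg]

lemma IsPeriodic.le_stabilizer {G : Type*} [AddCommGroup G] {H : AddSubgroup G} {S : Set G}
    (hS : IsPeriodic H S) : H ≤ AddAction.stabilizer G S := by
  intro h hh
  rw [AddAction.mem_stabilizer_iff]
  ext x
  rw [mem_vadd_set_iff_sub_mem, sub_eq_add_neg, hS.add_mem_iff (neg_mem hh)]

lemma isPeriodic_stabilizer {G : Type*} [AddCommGroup G] (S : Set G) :
    IsPeriodic (AddAction.stabilizer G S) S := by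
  intro p hp h hh
  rw [AddAction.mem_stabilizer_iff] at hh
  rw [← hh, mem_vadd_set_iff_sub_mem, add_sub_cancel_right]
  exact hp

lemma setOf_add_singleton_eq {G : Type*} [AddCommGroup G] (S : Set G) :
    {γ : G | S + {γ} = S} = AddAction.stabilizer G S := by
  ext γ
  rw [Set.mem_ofPred_eq, add_singleton_eq_vadd, SetLike.mem_coe, AddAction.mem_stabilizer_iff]

namespace IsErgodicContent

variable {G : Type*} [AddCommGroup G] {μ ν : Set G → ℝ} {A B C : Set G} {K L : AddSubgroup G}

theorem exists_stabilizer (hμ : IsErgodicContent μ) (hA : A.Nonempty) (hB : B.Nonempty)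
    (hlt : μ (A + B) < μ A + μ B) :
    ∃ K : AddSubgroup G, K.FiniteIndex ∧ μ (A + B) = μ (A + B + K) ∧
      μ (A + B + K) = μ (A + K) + μ (B + K) - μ K ∧
      (K : Set G) = {γ : G | A + B + K + {γ} = A + B + K} := by
  obtain ⟨H, hH, hCH, -⟩ := hμ.exists_addSubgroup_of_small_sum hA hB hlt
  set S := A + B + (H : Set G) with hS
  set K := AddAction.stabilizer G S with hK
  have hHK : H ≤ K := (IsPeriodic.add_coe (A + B) H).le_stabilizer
  have hKfin : K.FiniteIndex := AddSubgroup.finiteIndex_of_le hHK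
  have hSK : IsPeriodic K S := isPeriodic_stabilizer S
  have hABK : A + B + (K : Set G) = S := by
    refine Set.Subset.antisymm ?_ (Set.add_subset_add_left hHK)
    rintro _ ⟨c, hc, k, hk, rfl⟩
    exact hSK c (subset_add_coe _ H hc) k hk
  have hsum : (A + (K : Set G)) + (B + (K : Set G)) = S := by
    have hKK : (K : Set G) + K = K :=
      IsPeriodic.add_coe_eq (H := K) (P := K) fun p hp h hh => add_mem hp hh
    rw [add_add_add_comm, hKK, hABK]
  have hAK := hμ.mono (subset_add_coe A K)
  have hBK := hμ.mono (subset_add_coe B K)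
  have hltK : μ S < μ (A + K) + μ (B + K) := by linarith
  obtain ⟨L, hL, hSL, hle⟩ := hμ.exists_addSubgroup_of_small_sum
    (hA.mono (subset_add_coe A K)) (hB.mono (subset_add_coe B K)) (by rwa [hsum])
  rw [hsum] at hSL hle
  have hSeq : S = S + (L : Set G) :=
    hμ.eq_of_subset (H := K ⊓ L) inferInstance (hSK.mono inf_le_left)
      ((IsPeriodic.add_coe S L).mono inf_le_right) (subset_add_coe S L) hSL.le
  have hLK : L ≤ K := IsPeriodic.le_stabilizer (by rw [hSeq]; exact IsPeriodic.add_coe S L)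
  have hLK' : μ L ≤ μ K := hμ.mono hLK
  refine ⟨K, hKfin, by rw [hABK, hCH], ?_, by rw [hABK, setOf_add_singleton_eq]⟩
  rw [hABK]
  refine le_antisymm ?_ (by linarith)
  obtain ⟨n, hn⟩ := hμ.exists_eq_mul hKfin hSK
  obtain ⟨a, ha⟩ := hμ.exists_eq_mul hKfin (IsPeriodic.add_coe A K)
  obtain ⟨b, hb⟩ := hμ.exists_eq_mul hKfin (IsPeriodic.add_coe B K)
  have hK0 := hμ.pos_of_finiteIndex hKfin
  rw [hn, ha, hb] at hltK ⊢
  rw [← add_mul] at hltK ⊢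
  have h1 : n + 1 ≤ a + b := by exact_mod_cast lt_of_mul_lt_mul_right hltK hK0.le
  have h2 : (n + 1 : ℝ) ≤ a + b := by exact_mod_cast h1
  linarith [mul_le_mul_of_nonneg_right h2 hK0.le]

lemma add_coe_eq_of_le (hμ : IsErgodicContent μ) (hL : L.FiniteIndex)
    (hLK : L ≤ K) (h : μ C = μ (C + K)) : C + (L : Set G) = C + (K : Set G) :=
  hμ.eq_of_subset hL (IsPeriodic.add_coe C L) ((IsPeriodic.add_coe C K).mono hLK)
    (Set.add_subset_add_left hLK) (h ▸ hμ.mono (subset_add_coe C L))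

lemma addSubgroup_eq (hμ : IsErgodicContent μ) (hν : IsErgodicContent ν) (hK : K.FiniteIndex)
    (hL : L.FiniteIndex) (hKC : μ C = μ (C + K)) (hLC : ν C = ν (C + L))
    (hKs : (K : Set G) = {γ : G | C + K + {γ} = C + K})
    (hLs : (L : Set G) = {γ : G | C + L + {γ} = C + L}) : K = L := by
  have h1 := hμ.add_coe_eq_of_le (L := K ⊓ L) inferInstance inf_le_left hKC
  have h2 := hν.add_coe_eq_of_le (L := K ⊓ L) inferInstance inf_le_right hLC
  apply SetLike.coe_injective
  rw [hKs, hLs, ← h1, ← h2]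

end IsErgodicContent

section Means

variable {Γ : Type*} [AddCommGroup Γ] [TopologicalSpace Γ] [DiscreteTopology Γ]
  {m : BoundedContinuousFunction Γ ℝ →ₗ[ℝ] ℝ} {A B : Set Γ}

@[simp]
lemma ind_apply (A : Set Γ) (x : Γ) : ind Γ A x = A.indicator 1 x := rfl

@[simp]
lemma translate_apply (γ x : Γ) (f : BoundedContinuousFunction Γ ℝ) :
    translate Γ γ f x = f (x - γ) := rfl

lemma translate_add (γ : Γ) (f g : BoundedContinuousFunction Γ ℝ) :
    translate Γ γ (f + g) = translate Γ γ f + translate Γ γ g := rfl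

lemma translate_smul (γ : Γ) (c : ℝ) (f : BoundedContinuousFunction Γ ℝ) :
    translate Γ γ (c • f) = c • translate Γ γ f := rfl

lemma norm_translate_le (γ : Γ) (f : BoundedContinuousFunction Γ ℝ) :
    ‖translate Γ γ f‖ ≤ ‖f‖ :=
  f.norm_compContinuous_le _

namespace IsInvariantMean

lemma mono (hm : IsInvariantMean Γ m) {f g : BoundedContinuousFunction Γ ℝ}
    (h : ∀ x, f x ≤ g x) : m f ≤ m g := by
  have := hm.nonneg (g - f) fun x => sub_nonneg.2 (h x)
  rwa [map_sub, sub_nonneg] at this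

lemma abs_le_norm (hm : IsInvariantMean Γ m) (f : BoundedContinuousFunction Γ ℝ) :
    |m f| ≤ ‖f‖ := by
  have h : ∀ c : ℝ, m (c • 1) = c := fun c => by rw [map_smul, hm.map_one, smul_eq_mul, mul_one]
  have hf : ∀ x, |f x| ≤ ‖f‖ := fun x => f.norm_coe_le_norm x
  rw [abs_le]
  constructor
  · rw [← h (-‖f‖)]
    exact hm.mono fun x => by simpa using (abs_le.1 (hf x)).1
  · rw [← h ‖f‖]
    exact hm.mono fun x => by simpa using (abs_le.1 (hf x)).2

/-- The correlation function `e ↦ m (w * τ_e f)`. -/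
noncomputable def corr (hm : IsInvariantMean Γ m) (w f : BoundedContinuousFunction Γ ℝ) :
    BoundedContinuousFunction Γ ℝ :=
  BoundedContinuousFunction.ofNormedAddCommGroup (fun e => m (w * translate Γ e f))
    continuous_of_discreteTopology (‖w‖ * ‖f‖) fun e =>
      (hm.abs_le_norm _).trans <| (norm_mul_le _ _).trans <|
        mul_le_mul_of_nonneg_left (norm_translate_le e f) (norm_nonneg w)

@[simp]
lemma corr_apply (hm : IsInvariantMean Γ m) (w f : BoundedContinuousFunction Γ ℝ) (e : Γ) :
    hm.corr w f e = m (w * translate Γ e f) := rfl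

/-- The functional `f ↦ m (e ↦ m (w * τ_e f))`. -/
noncomputable def corrMean (hm : IsInvariantMean Γ m) (w : BoundedContinuousFunction Γ ℝ) :
    BoundedContinuousFunction Γ ℝ →ₗ[ℝ] ℝ where
  toFun f := m (hm.corr w f)
  map_add' f g := by
    rw [← map_add]
    congr 1
    ext e
    simp [translate_add, mul_add]
  map_smul' c f := by
    rw [RingHom.id_apply, ← map_smul]
    congr 1
    ext e
    simp [translate_smul]
    rw [mul_smul_comm, map_smul, smul_eq_mul]

lemma corrMean_apply (hm : IsInvariantMean Γ m) (w f : BoundedContinuousFunction Γ ℝ) :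
    hm.corrMean w f = m (hm.corr w f) := rfl

lemma corrMean_add (hm : IsInvariantMean Γ m) (v w : BoundedContinuousFunction Γ ℝ) :
    hm.corrMean (v + w) = hm.corrMean v + hm.corrMean w := by
  ext f
  rw [LinearMap.add_apply, corrMean_apply, corrMean_apply, corrMean_apply, ← map_add]
  congr 1
  ext e
  simp [add_mul]

lemma corrMean_smul (hm : IsInvariantMean Γ m) (c : ℝ) (w : BoundedContinuousFunction Γ ℝ) :
    hm.corrMean (c • w) = c • hm.corrMean w := by
  ext f
  rw [LinearMap.smul_apply, corrMean_apply, corrMean_apply, ← map_smul]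
  congr 1
  ext e
  simp
  rw [smul_mul_assoc, map_smul, smul_eq_mul]

lemma corrMean_one (hm : IsInvariantMean Γ m) : hm.corrMean 1 = m := by
  ext f
  have : hm.corr 1 f = m f • 1 := by
    ext e
    simp [hm.invariant]
  rw [corrMean_apply, this, map_smul, hm.map_one, smul_eq_mul, mul_one]

lemma corrMean_apply_one (hm : IsInvariantMean Γ m) (w : BoundedContinuousFunction Γ ℝ) :
    hm.corrMean w 1 = m w := by
  have : hm.corr w 1 = m w • 1 := by
    ext e
    have h1 : translate Γ e 1 = 1 := rfl
    simp [h1]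
  rw [corrMean_apply, this, map_smul, hm.map_one, smul_eq_mul, mul_one]

lemma inv_smul_corrMean (hm : IsInvariantMean Γ m) {w : BoundedContinuousFunction Γ ℝ}
    (hw : ∀ x, 0 ≤ w x) (hmw : 0 < m w) : IsInvariantMean Γ ((m w)⁻¹ • hm.corrMean w) where
  map_one := by
    rw [LinearMap.smul_apply, corrMean_apply_one, smul_eq_mul, inv_mul_cancel₀ hmw.ne']
  nonneg f hf := by
    refine mul_nonneg (inv_nonneg.2 hmw.le) (hm.nonneg _ fun e => hm.nonneg _ fun x => ?_)
    exact mul_nonneg (hw x) (hf _)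
  invariant γ f := by
    have : hm.corr w (translate Γ γ f) = translate Γ (-γ) (hm.corr w f) := by
      ext e
      have h1 : translate Γ e (translate Γ γ f) = translate Γ (e - -γ) f := by
        ext x
        simp [sub_sub]
      simp only [corr_apply, translate_apply, h1]
    rw [LinearMap.smul_apply, LinearMap.smul_apply, corrMean_apply, corrMean_apply, this,
      hm.invariant]

end IsInvariantMean

lemma IsExtremeInvariantMean.corrMean_eq (hm : IsExtremeInvariantMean Γ m)
    {w : BoundedContinuousFunction Γ ℝ} (hw0 : ∀ x, 0 ≤ w x) (hw1 : ∀ x, w x ≤ 1)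
    (h0 : 0 < m w) (h1 : m w < 1) :
    IsInvariantMean.corrMean hm.1 w = m w • m := by
  have him : IsInvariantMean Γ m := hm.1
  have hsub : m (1 - w) = 1 - m w := by rw [map_sub, him.map_one]
  have hpos : 0 < m (1 - w) := by rw [hsub]; linarith
  have heq := hm.2 (him.inv_smul_corrMean hw0 h0)
    (him.inv_smul_corrMean (w := 1 - w) (fun x => sub_nonneg.2 (hw1 x)) hpos)
    ⟨m w, m (1 - w), h0, hpos, by rw [hsub]; ring, by
      rw [smul_inv_smul₀ h0.ne', smul_inv_smul₀ hpos.ne', ← him.corrMean_add,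
        add_sub_cancel, him.corrMean_one]⟩
  exact (inv_smul_eq_iff₀ h0.ne').1 heq

lemma mVal_nonneg (hm : IsInvariantMean Γ m) (A : Set Γ) : 0 ≤ mVal Γ m A :=
  hm.nonneg _ fun _ => Set.indicator_nonneg (fun _ _ => zero_le_one) _

lemma mVal_le_one (hm : IsInvariantMean Γ m) (A : Set Γ) : mVal Γ m A ≤ 1 := by
  rw [← hm.map_one]
  exact hm.mono fun x => Set.indicator_le_self' (fun _ _ => zero_le_one) x

lemma IsExtremeInvariantMean.corrMean_ind (hm : IsExtremeInvariantMean Γ m) (A : Set Γ)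
    (f : BoundedContinuousFunction Γ ℝ) :
    IsInvariantMean.corrMean hm.1 (ind Γ A) f = mVal Γ m A * m f := by
  have him : IsInvariantMean Γ m := hm.1
  have hA0 := mVal_nonneg him A
  have hA1 := mVal_le_one him A
  have hind : ∀ x, 0 ≤ ind Γ A x ∧ ind Γ A x ≤ 1 := fun x =>
    ⟨Set.indicator_nonneg (fun _ _ => zero_le_one) x,
      Set.indicator_le_self' (fun _ _ => zero_le_one) x⟩
  have hval : m ((3⁻¹ : ℝ) • (1 + ind Γ A)) = 3⁻¹ * (1 + mVal Γ m A) := by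
    rw [map_smul, map_add, him.map_one, smul_eq_mul, mVal]
  have key := hm.corrMean_eq (w := (3⁻¹ : ℝ) • (1 + ind Γ A))
    (fun x => by
      have := hind x
      change 0 ≤ (3⁻¹ : ℝ) * (1 + ind Γ A x)
      linarith)
    (fun x => by
      have := hind x
      change (3⁻¹ : ℝ) * (1 + ind Γ A x) ≤ 1
      linarith)
    (by rw [hval]; linarith) (by rw [hval]; linarith)
  rw [IsInvariantMean.corrMean_smul, IsInvariantMean.corrMean_add, IsInvariantMean.corrMean_one,
    hval] at key
  have := congrArg (fun L => L f) key
  simp only [LinearMap.smul_apply, LinearMap.add_apply, smul_eq_mul] at this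
  linarith

lemma translate_ind (e : Γ) (B : Set Γ) : translate Γ e (ind Γ B) = ind Γ (e +ᵥ B) := by
  classical
  ext x
  simp only [translate_apply, ind_apply, Set.indicator_apply, Pi.one_apply,
    mem_vadd_set_iff_sub_mem]

lemma ind_mul_ind (A B : Set Γ) : ind Γ A * ind Γ B = ind Γ (A ∩ B) := by
  ext x
  exact (congrFun (Set.inter_indicator_one (s := A) (t := B) (M₀ := ℝ)) x).symm

lemma IsExtremeInvariantMean.apply_corr_ind (hm : IsExtremeInvariantMean Γ m) (A B : Set Γ) :
    m (IsInvariantMean.corr hm.1 (ind Γ A) (ind Γ B)) = mVal Γ m A * mVal Γ m B :=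
  hm.corrMean_ind A (ind Γ B)

lemma IsInvariantMean.corr_ind (hm : IsInvariantMean Γ m) (A B : Set Γ) (e : Γ) :
    hm.corr (ind Γ A) (ind Γ B) e = mVal Γ m (A ∩ (e +ᵥ B)) := by
  rw [IsInvariantMean.corr_apply, translate_ind, ind_mul_ind, mVal]

theorem IsExtremeInvariantMean.isErgodicContent (hm : IsExtremeInvariantMean Γ m) :
    IsErgodicContent (mVal Γ m) := by
  classical
  have him : IsInvariantMean Γ m := hm.1
  refine ⟨mVal_nonneg him, ?_, fun A B hAB => ?_, fun e A => ?_, fun A B D t h => ?_,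
    fun A B D t h hD => ?_⟩
  · rw [mVal, ← him.map_one]
    congr 1
    ext x
    simp
  · rw [mVal, mVal, mVal, ← map_add]
    congr 1
    ext x
    simp [Set.indicator_union_of_disjoint hAB]
  · rw [mVal, ← translate_ind, him.invariant, mVal]
  · rw [← hm.apply_corr_ind, mVal, ← smul_eq_mul, ← map_smul]
    refine him.mono fun e => ?_
    rw [him.corr_ind]
    by_cases he : e ∈ D
    · simpa [he] using h e he
    · simpa [he] using mVal_nonneg him _
  · rw [← hm.apply_corr_ind, mVal, ← smul_eq_mul, ← map_smul]
    refine him.mono fun e => ?_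
    rw [him.corr_ind]
    by_cases he : e ∈ D
    · simpa [he] using h e
    · have h1 : A ∩ (e +ᵥ B) = ∅ := by
        by_contra hne
        exact he (hD e (Set.nonempty_iff_ne_empty.2 hne))
      have h2 : ind Γ (∅ : Set Γ) = 0 := by
        ext x
        simp
      simp [he, h1, mVal, h2]

end Means

theorem exists_KJStabilizer (A B : Set Γ) (hA : A.Nonempty) (hB : B.Nonempty) :
    ∃ K : AddSubgroup Γ, IsKJStabilizer Γ A B K ∧
      ((∃ ν : BoundedContinuousFunction Γ ℝ →ₗ[ℝ] ℝ, IsExtremeInvariantMean Γ ν ∧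
          mVal Γ ν (A + B) < mVal Γ ν A + mVal Γ ν B) →
        ∀ K' : AddSubgroup Γ, IsKJStabilizer Γ A B K' → K' = K) := by
  by_cases hex : ∃ ν : BoundedContinuousFunction Γ ℝ →ₗ[ℝ] ℝ, IsExtremeInvariantMean Γ ν ∧
      mVal Γ ν (A + B) < mVal Γ ν A + mVal Γ ν B
  · obtain ⟨ν, hν, hlt⟩ := hex
    obtain ⟨K, hK, hKC, hKeq, hKs⟩ := hν.isErgodicContent.exists_stabilizer hA hB hlt
    refine ⟨K, ⟨hK, fun ν' hν' hlt' => ?_⟩, fun _ K' hK' => ?_⟩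
    · obtain ⟨L, hL, hLC, hLeq, hLs⟩ := hν'.isErgodicContent.exists_stabilizer hA hB hlt'
      obtain rfl : L = K :=
        hν'.isErgodicContent.addSubgroup_eq hν.isErgodicContent hL hK hLC hKC hLs hKs
      exact ⟨hLC, hLeq, hLs⟩
    · obtain ⟨hKC', -, hKs'⟩ := hK'.2 ν hν hlt
      exact hν.isErgodicContent.addSubgroup_eq hν.isErgodicContent hK'.1 hK hKC' hKC hKs' hKs
  · exact ⟨⊤, ⟨inferInstance, fun ν hν hlt => absurd ⟨ν, hν, hlt⟩ hex⟩, fun h => absurd h hex⟩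

end SumsetMeans
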